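/- Let (V,σ) be a braided vector space over a field K, with σ : V⊗V → V⊗V satisfying the braid equation. Then the quantum shuffle product on T(V), defined by (v₁⊗⋯⊗v_p)•(v_{p+1}⊗⋯⊗v_{p+q}) = Σ_{s ∈ Sh(p,q)} T_s(v₁⊗⋯⊗v_{p+q}), is associative, where T_s ∈ End(V^{⊗n}) is obtained by choosing a reduced word for s and replacing each simple transposition s_i by id^{⊗(i−1)} ⊗ σ ⊗ id^{⊗(n−i−1)}. -/

import Mathlib

open scoped TensorProduct

universe u

def IsShuffleOn {n : ℕ} (i p q : ℕ) (σ : Equiv.Perm (Fin n)) : Prop :=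
  (∀ a : Fin n, ((a : ℕ) < i ∨ i + p + q ≤ (a : ℕ)) → σ a = a) ∧
  (∀ a b : Fin n, a < b → i ≤ (a : ℕ) → (b : ℕ) < i + p → σ.symm a < σ.symm b) ∧
  (∀ a b : Fin n, a < b → i + p ≤ (a : ℕ) → (b : ℕ) < i + p + q → σ.symm a < σ.symm b)

def IsSimpleT {n : ℕ} (σ : Equiv.Perm (Fin n)) : Prop :=
  ∃ i : ℕ, ∃ h : i + 1 < n, σ = Equiv.swap ⟨i, by omega⟩ ⟨i + 1, h⟩

noncomputable def permLength {n : ℕ} (σ : Equiv.Perm (Fin n)) : ℕ :=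
  sInf {m | ∃ w : List (Equiv.Perm (Fin n)),
    (∀ x ∈ w, IsSimpleT x) ∧ w.prod = σ ∧ w.length = m}

def simpleT (n : ℕ) (i : Fin (n - 1)) : Equiv.Perm (Fin n) :=
  Equiv.swap ⟨(i : ℕ), by have := i.isLt; omega⟩ ⟨(i : ℕ) + 1, by have := i.isLt; omega⟩

def wordPerm (n : ℕ) : FreeMonoid (Fin (n - 1)) →* Equiv.Perm (Fin n) :=
  FreeMonoid.lift (simpleT n)

/-- The iterated tensor power `T(n) = V ⊗ (V ⊗ (⋯ ⊗ K))`, bundled with its module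
structure. -/
noncomputable def TP (K : Type u) [Field K] (V : Type u) [AddCommGroup V] [Module K V] :
    ℕ → ModuleCat K
  | 0 => ModuleCat.of K K
  | n + 1 => ModuleCat.of K (V ⊗[K] TP K V n)

/-- The operator `id^{⊗ i} ⊗ σ ⊗ id^{⊗ (n-i-2)}` on `V^{⊗ n}` (0-based `i`), applying
`σ : V ⊗ V → V ⊗ V` to the tensorands in positions `i+1, i+2` (1-based). -/
noncomputable def applyAt (K : Type u) [Field K] (V : Type u) [AddCommGroup V] [Module K V]
    (σ : V ⊗[K] V →ₗ[K] V ⊗[K] V) : (n i : ℕ) → TP K V n →ₗ[K] TP K V n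
  | 0, _ => LinearMap.id
  | 1, _ => LinearMap.id
  | n + 2, 0 =>
      (TensorProduct.assoc K V V (TP K V n)).toLinearMap ∘ₗ
        LinearMap.rTensor (TP K V n) σ ∘ₗ
        (TensorProduct.assoc K V V (TP K V n)).symm.toLinearMap
  | n + 1, i + 1 => LinearMap.lTensor V (applyAt K V σ n i)

/-- Transport along an equality of degrees. -/
noncomputable def castTP (K : Type u) [Field K] (V : Type u) [AddCommGroup V] [Module K V]
    {m n : ℕ} (h : m = n) : TP K V m →ₗ[K] TP K V n := by
  subst h; exact LinearMap.id

/-- The canonical identification `V^{⊗p} ⊗ V^{⊗q} → V^{⊗(p+q)}`. -/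
noncomputable def combineTP (K : Type u) [Field K] (V : Type u) [AddCommGroup V]
    [Module K V] : (p q : ℕ) → (TP K V p ⊗[K] TP K V q) →ₗ[K] TP K V (p + q)
  | 0, q => castTP K V (zero_add q).symm ∘ₗ (TensorProduct.lid K (TP K V q)).toLinearMap
  | p + 1, q =>
      castTP K V (Nat.succ_add p q).symm ∘ₗ
        LinearMap.lTensor V (combineTP K V p q) ∘ₗ
        (TensorProduct.assoc K V (TP K V p) (TP K V q)).toLinearMap

/-- The operator `T_s`-candidate attached to a word `w = [i₁,…,i_ℓ]` in the braid
generators: the composition of the operators `σ_{i}` along `w` (the first letter of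
`w` acting first, matching the paper's left-to-right products). -/
noncomputable def opWord (K : Type u) [Field K] (V : Type u) [AddCommGroup V] [Module K V]
    (σ : V ⊗[K] V →ₗ[K] V ⊗[K] V) (n : ℕ) (w : List (Fin (n - 1))) :
    TP K V n →ₗ[K] TP K V n :=
  ((w.map fun i => (applyAt K V σ n (i : ℕ) : Module.End K (TP K V n))).reverse).prod

open scoped Classical in
/-- The quantum shuffle product
`x • y = Σ_{s ∈ Sh(p,q)} T_s (x ⊗ y)`, where `T_s` is built from a chosen reduced word
`R (p+q) s` of `s` by replacing each simple transposition `s_i` by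
`id^{⊗(i-1)} ⊗ σ ⊗ id^{⊗(n-i-1)}`. -/
noncomputable def qShuffleProd (K : Type u) [Field K] (V : Type u) [AddCommGroup V]
    [Module K V] (σ : V ⊗[K] V →ₗ[K] V ⊗[K] V)
    (R : ∀ n, Equiv.Perm (Fin n) → List (Fin (n - 1))) (p q : ℕ)
    (x : TP K V p) (y : TP K V q) : TP K V (p + q) :=
  ∑ s : Equiv.Perm (Fin (p + q)),
    if IsShuffleOn 0 p q s then
      opWord K V σ (p + q) (R (p + q) s) (combineTP K V p q (x ⊗ₜ[K] y))
    else 0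


section BraidSums

variable {K M N : Type*} [CommSemiring K] [AddCommMonoid M] [Module K M]
  [AddCommMonoid N] [Module K N]

/-- The descending product `A (b + k - 1) * ⋯ * A (b + 1) * A b`. -/
def descProd (A : ℕ → Module.End K M) : ℕ → ℕ → Module.End K M
  | _, 0 => 1
  | b, k + 1 => descProd A (b + 1) k * A b

/-- The sum of the operators attached to the `(p, q)`-shuffles, placed at offset `a`, given by
recursion on the position of the last letter. -/
def shuffleSum (A : ℕ → Module.End K M) (a : ℕ) : ℕ → ℕ → Module.End K M
  | 0, _ => 1
  | _ + 1, 0 => 1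
  | p + 1, q + 1 =>
      shuffleSum A a (p + 1) q + shuffleSum A a p (q + 1) * descProd A (a + p) (q + 1)
termination_by p q => p + q

@[simp]
lemma shuffleSum_zero_left (A : ℕ → Module.End K M) (a q : ℕ) : shuffleSum A a 0 q = 1 := by
  rw [shuffleSum]

@[simp]
lemma shuffleSum_zero_right (A : ℕ → Module.End K M) (a p : ℕ) : shuffleSum A a p 0 = 1 := by
  cases p <;> rw [shuffleSum]

lemma shuffleSum_succ_succ (A : ℕ → Module.End K M) (a p q : ℕ) :
    shuffleSum A a (p + 1) (q + 1) =
      shuffleSum A a (p + 1) q + shuffleSum A a p (q + 1) * descProd A (a + p) (q + 1) := by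
  rw [shuffleSum]

lemma descProd_intertwine (A : ℕ → Module.End K M) (B : ℕ → Module.End K N) (Φ : M →ₗ[K] N)
    (a b k : ℕ) (h : ∀ i < k, ∀ x, Φ (A (a + i) x) = B (b + i) (Φ x)) (x : M) :
    Φ (descProd A a k x) = descProd B b k (Φ x) := by
  induction k generalizing a b x with
  | zero => rfl
  | succ k ih =>
    have h0 := h 0 (by omega)
    simp only [add_zero] at h0
    simp only [descProd, Module.End.mul_apply]
    rw [ih (a + 1) (b + 1) _, h0]
    intro i hi y
    have := h (i + 1) (by omega) y
    rwa [← add_assoc, ← add_assoc, add_right_comm a, add_right_comm b] at this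

lemma shuffleSum_intertwine (A : ℕ → Module.End K M) (B : ℕ → Module.End K N) (Φ : M →ₗ[K] N)
    (a b p q : ℕ) (h : ∀ i, i + 1 < p + q → ∀ x, Φ (A (a + i) x) = B (b + i) (Φ x)) (x : M) :
    Φ (shuffleSum A a p q x) = shuffleSum B b p q (Φ x) := by
  induction p generalizing q x with
  | zero => simp
  | succ p ihp =>
    induction q generalizing x with
    | zero => simp
    | succ q ihq =>
      simp only [shuffleSum_succ_succ, LinearMap.add_apply, Module.End.mul_apply, map_add]
      rw [ihq (fun i hi => h i (by omega)), ihp (q + 1) (fun i hi => h i (by omega)),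
        descProd_intertwine A B Φ (a + p) (b + p)]
      intro i hi y
      rw [add_assoc, add_assoc]
      exact h _ (by omega) y

lemma descProd_mul_of_far {A : ℕ → Module.End K M}
    (hfar : ∀ i j, i + 2 ≤ j → A i * A j = A j * A i) (b k i : ℕ) (hi : i + 2 ≤ b) :
    descProd A b k * A i = A i * descProd A b k := by
  induction k generalizing b with
  | zero => simp [descProd]
  | succ k ih =>
    rw [descProd, mul_assoc, ← hfar i b hi, ← mul_assoc, ih (b + 1) (by omega), mul_assoc]

lemma descProd_add (A : ℕ → Module.End K M) (b k l : ℕ) :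
    descProd A (b + k) l * descProd A b k = descProd A b (k + l) := by
  induction k generalizing b with
  | zero => simp [descProd]
  | succ k ih =>
    rw [add_right_comm k 1 l, descProd, descProd, ← ih (b + 1), mul_assoc, add_right_comm b 1 k,
      add_assoc b k 1]

lemma descProd_mul_succ {A : ℕ → Module.End K M} {m : ℕ}
    (hfar : ∀ i j, i + 2 ≤ j → A i * A j = A j * A i)
    (hbraid : ∀ i, i + 2 < m → A i * A (i + 1) * A i = A (i + 1) * A i * A (i + 1))
    (b k i : ℕ) (hbi : b ≤ i) (hik : i + 1 < b + k) (hm : b + k < m) :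
    descProd A b k * A (i + 1) = A i * descProd A b k := by
  induction k generalizing b with
  | zero => omega
  | succ k ih =>
    rcases hbi.eq_or_lt with rfl | hlt
    · obtain ⟨k, rfl⟩ : ∃ l, k = l + 1 := ⟨k - 1, by omega⟩
      rw [descProd, descProd]
      calc descProd A (b + 1 + 1) k * A (b + 1) * A b * A (b + 1)
          = descProd A (b + 1 + 1) k * (A (b + 1) * A b * A (b + 1)) := by simp only [mul_assoc]
        _ = descProd A (b + 1 + 1) k * A b * (A (b + 1) * A b) := by
            rw [← hbraid b (by omega)]; simp only [mul_assoc]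
        _ = _ := by
            rw [descProd_mul_of_far hfar _ _ _ (by omega)]; simp only [mul_assoc]
    · rw [descProd, mul_assoc, hfar b (i + 1) (by omega), ← mul_assoc,
        ih (b + 1) (by omega) (by omega) (by omega), mul_assoc]

lemma descProd_mul_shuffleSum_of_far {A : ℕ → Module.End K M}
    (hfar : ∀ i j, i + 2 ≤ j → A i * A j = A j * A i) (a p q b k : ℕ) (h : a + p + q ≤ b) :
    descProd A b k * shuffleSum A a p q = shuffleSum A a p q * descProd A b k := by
  refine LinearMap.ext fun x => ?_
  refine shuffleSum_intertwine A A (descProd A b k) a a p q (fun i hi y => ?_) x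
  exact LinearMap.congr_fun (descProd_mul_of_far hfar b k (a + i) (by omega)) y

lemma descProd_mul_shuffleSum_succ {A : ℕ → Module.End K M} {m : ℕ}
    (hfar : ∀ i j, i + 2 ≤ j → A i * A j = A j * A i)
    (hbraid : ∀ i, i + 2 < m → A i * A (i + 1) * A i = A (i + 1) * A i * A (i + 1))
    (a p q b k : ℕ) (hba : b ≤ a) (hk : a + p + q ≤ b + k) (hm : b + k < m) :
    descProd A b k * shuffleSum A (a + 1) p q = shuffleSum A a p q * descProd A b k := by
  refine LinearMap.ext fun x => ?_
  refine shuffleSum_intertwine A A (descProd A b k) (a + 1) a p q (fun i hi y => ?_) x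
  rw [add_right_comm]
  exact LinearMap.congr_fun
    (descProd_mul_succ hfar hbraid b k (a + i) (by omega) (by omega) (by omega)) y

/-- The sums over shuffles in a representation of the braid monoid satisfy the associativity
relation of the quantum shuffle product. -/
theorem shuffleSum_assoc {A : ℕ → Module.End K M} {m : ℕ}
    (hfar : ∀ i j, i + 2 ≤ j → A i * A j = A j * A i)
    (hbraid : ∀ i, i + 2 < m → A i * A (i + 1) * A i = A (i + 1) * A i * A (i + 1))
    (a p q r : ℕ) (hm : a + p + q + r ≤ m) :
    shuffleSum A a (p + q) r * shuffleSum A a p q =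
      shuffleSum A a p (q + r) * shuffleSum A (a + p) q r := by
  match p, q, r with
  | 0, q, r => simp
  | p, 0, r => simp
  | p, q, 0 => simp
  | p + 1, q + 1, r + 1 =>
    have h1 := shuffleSum_assoc hfar hbraid a (p + 1) (q + 1) r (by omega)
    have h2 := shuffleSum_assoc hfar hbraid a (p + 1) q (r + 1) (by omega)
    have h3 := shuffleSum_assoc hfar hbraid a p (q + 1) (r + 1) (by omega)
    have c1 := descProd_mul_shuffleSum_of_far hfar a (p + 1) q (a + (p + q + 1)) (r + 1) (by omega)
    have c2 := descProd_mul_shuffleSum_of_far hfar a p (q + 1) (a + (p + q + 1)) (r + 1) (by omega)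
    have c3 := descProd_add A (a + p) (q + 1) (r + 1)
    have c4 := descProd_mul_shuffleSum_succ hfar hbraid (a + p) (q + 1) (r + 1) (a + p)
      (q + r + 1 + 1) le_rfl (by omega) (by omega)
    have e1 : shuffleSum A a (p + 1 + (q + 1)) (r + 1) =
        shuffleSum A a (p + 1 + (q + 1)) r + shuffleSum A a (p + q + 1) (r + 1) *
          descProd A (a + (p + q + 1)) (r + 1) := by
      rw [show p + 1 + (q + 1) = (p + q + 1) + 1 by omega, shuffleSum_succ_succ]
    have e2 := shuffleSum_succ_succ A a p q
    have e3 := shuffleSum_succ_succ A a p (q + r + 1)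
    have e4 := shuffleSum_succ_succ A (a + p + 1) q r
    rw [show p + 1 + q = p + q + 1 by omega] at h2
    rw [show p + (q + 1) = p + q + 1 by omega] at h3
    rw [show q + 1 + r = q + r + 1 by omega] at h1
    rw [show q + (r + 1) = q + r + 1 by omega] at h2
    rw [show q + 1 + (r + 1) = q + r + 1 + 1 by omega] at h3 c3 ⊢
    rw [show a + p + (q + 1) = a + (p + q + 1) by omega] at c3
    rw [show a + p + 1 + q = a + (p + q + 1) by omega] at e4
    rw [← add_assoc a p 1] at h1 h2 ⊢
    rw [e1, add_mul, h1]
    conv_lhs => rw [e2]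
    rw [mul_add, mul_assoc _ _ (shuffleSum A a (p + 1) q), c1, ← mul_assoc, h2,
      mul_assoc _ _ (shuffleSum A a p (q + 1) * _), ← mul_assoc _ (shuffleSum A a p (q + 1)), c2,
      mul_assoc _ _ (descProd A (a + p) (q + 1)), c3, ← mul_assoc, h3, e3, add_mul,
      mul_assoc _ _ (shuffleSum A (a + p + 1) _ _), c4]
    conv_rhs => enter [1]; rw [e4]
    simp only [mul_add, mul_assoc, add_assoc]
termination_by p + q + r

end BraidSums

section TensorPowers

variable {K : Type u} [Field K] {V : Type u} [AddCommGroup V] [Module K V]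
  {σ : V ⊗[K] V →ₗ[K] V ⊗[K] V}

lemma castTP_self {n : ℕ} (h : n = n) (x : TP K V n) : castTP K V h x = x := rfl

lemma castTP_castTP {l m n : ℕ} (h : l = m) (h' : m = n) (x : TP K V l) :
    castTP K V h' (castTP K V h x) = castTP K V (h.trans h') x := by
  subst h h'; rfl

lemma castTP_applyAt {m n : ℕ} (h : m = n) (i : ℕ) (x : TP K V m) :
    castTP K V h (applyAt K V σ m i x) = applyAt K V σ n i (castTP K V h x) := by
  subst h; rfl

/-- The tensor `v ⊗ x` in `V^{⊗(n+1)}`. -/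
noncomputable def consTP (n : ℕ) : V →ₗ[K] TP K V n →ₗ[K] TP K V (n + 1) :=
  TensorProduct.mk K V (TP K V n)

/-- The tensor `t ⊗ x` in `V^{⊗(n+2)}`, for `t` in `V ⊗ V`. -/
noncomputable def consTwoTP (n : ℕ) (x : TP K V n) : V ⊗[K] V →ₗ[K] TP K V (n + 2) :=
  (TensorProduct.assoc K V V (TP K V n)).toLinearMap ∘ₗ
    (TensorProduct.mk K (V ⊗[K] V) (TP K V n)).flip x

/-- The identification `V^{⊗0} = K`. -/
noncomputable def scalarTP : TP K V 0 →ₗ[K] K := LinearMap.id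

/-- The unit of `V^{⊗0} = K`. -/
noncomputable def oneTP : TP K V 0 := (1 : K)

lemma scalarTP_oneTP : scalarTP (oneTP : TP K V 0) = (1 : K) := rfl

lemma consTwoTP_tmul (n : ℕ) (x : TP K V n) (v w : V) :
    consTwoTP n x (v ⊗ₜ w) = consTP (n + 1) v (consTP n w x) := rfl

/-- Linear maps on `V^{⊗(n+1)}` agree when they agree on the tensors `v ⊗ x`. -/
lemma TP_succ_ext {n : ℕ} {W : Type*} [AddCommMonoid W] [Module K W] {f g : TP K V (n + 1) →ₗ[K] W}
    (h : ∀ (v : V) (x : TP K V n), f (consTP n v x) = g (consTP n v x)) : f = g :=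
  TensorProduct.ext' (M := V) (N := TP K V n) h

lemma castTP_consTP {m n : ℕ} (h : m + 1 = n + 1) (v : V) (x : TP K V m) :
    castTP K V h (consTP m v x) = consTP n v (castTP K V (Nat.succ_injective h) x) := by
  obtain rfl : m = n := Nat.succ_injective h
  rfl

lemma applyAt_consTP (n i : ℕ) (v : V) (x : TP K V n) :
    applyAt K V σ (n + 1) (i + 1) (consTP n v x) = consTP n v (applyAt K V σ n i x) := by
  cases n <;> rfl

lemma applyAt_zero_consTwoTP (n : ℕ) (t : V ⊗[K] V) (x : TP K V n) :
    applyAt K V σ (n + 2) 0 (consTwoTP n x t) = consTwoTP n x (σ t) := by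
  change TensorProduct.assoc K V V (TP K V n) (LinearMap.rTensor (TP K V n) σ
    ((TensorProduct.assoc K V V (TP K V n)).symm
      (TensorProduct.assoc K V V (TP K V n) (t ⊗ₜ[K] x)))) = _
  rw [LinearEquiv.symm_apply_apply]
  rfl

lemma applyAt_consTwoTP (n i : ℕ) (t : V ⊗[K] V) (x : TP K V n) :
    applyAt K V σ (n + 2) (i + 2) (consTwoTP n x t) = consTwoTP n (applyAt K V σ n i x) t := by
  have : applyAt K V σ (n + 2) (i + 2) ∘ₗ consTwoTP n x = consTwoTP n (applyAt K V σ n i x) := by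
    refine TensorProduct.ext' fun v w => ?_
    rw [LinearMap.comp_apply, consTwoTP_tmul, consTwoTP_tmul, applyAt_consTP, applyAt_consTP]
  exact LinearMap.congr_fun this t

lemma TP_add_two_ext {n : ℕ} {W : Type*} [AddCommMonoid W] [Module K W]
    {f g : TP K V (n + 2) →ₗ[K] W}
    (h : ∀ (t : V ⊗[K] V) (x : TP K V n), f (consTwoTP n x t) = g (consTwoTP n x t)) : f = g := by
  refine TP_succ_ext fun v x => ?_
  have : f ∘ₗ consTP (n + 1) v = g ∘ₗ consTP (n + 1) v :=
    TP_succ_ext fun w y => h (v ⊗ₜ w) y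
  exact LinearMap.congr_fun this x

/-- The map `x ↦ x ⊗ y` from `V^{⊗p}` to `V^{⊗(p+q)}`. -/
noncomputable def appendTP (p q : ℕ) (y : TP K V q) : TP K V p →ₗ[K] TP K V (p + q) :=
  combineTP K V p q ∘ₗ (TensorProduct.mk K (TP K V p) (TP K V q)).flip y

lemma combineTP_tmul (p q : ℕ) (y : TP K V q) (x : TP K V p) :
    combineTP K V p q (x ⊗ₜ[K] y) = appendTP p q y x := rfl

lemma appendTP_zero (q : ℕ) (x : TP K V 0) (y : TP K V q) :
    appendTP 0 q y x = castTP K V (zero_add q).symm (scalarTP x • y) := rfl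

lemma appendTP_consTP (p q : ℕ) (v : V) (x : TP K V p) (y : TP K V q) :
    appendTP (p + 1) q y (consTP p v x) =
      castTP K V (Nat.succ_add p q).symm (consTP (p + q) v (appendTP p q y x)) := rfl

lemma appendTP_consTwoTP (p q : ℕ) (t : V ⊗[K] V) (x : TP K V p) (y : TP K V q) :
    appendTP (p + 2) q y (consTwoTP p x t) =
      castTP K V (Nat.add_right_comm p q 2) (consTwoTP (p + q) (appendTP p q y x) t) := by
  have : appendTP (p + 2) q y ∘ₗ consTwoTP p x =
      castTP K V (Nat.add_right_comm p q 2) ∘ₗ consTwoTP (p + q) (appendTP p q y x) := by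
    refine TensorProduct.ext' fun v w => ?_
    simp only [LinearMap.comp_apply]
    rw [consTwoTP_tmul, consTwoTP_tmul, appendTP_consTP, appendTP_consTP, ← castTP_consTP (by omega),
      castTP_castTP]
  exact LinearMap.congr_fun this t

lemma appendTP_applyAt_right (p q i : ℕ) (x : TP K V p) (y : TP K V q) :
    appendTP p q (applyAt K V σ q i y) x = applyAt K V σ (p + q) (p + i) (appendTP p q y x) := by
  induction p with
  | zero =>
    rw [appendTP_zero, appendTP_zero, ← castTP_applyAt, zero_add i, map_smul, map_smul, map_smul]
  | succ p ih =>
    have : appendTP (p + 1) q (applyAt K V σ q i y) =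
        applyAt K V σ (p + 1 + q) (p + 1 + i) ∘ₗ appendTP (p + 1) q y := by
      refine TP_succ_ext fun v x => ?_
      rw [LinearMap.comp_apply, appendTP_consTP, appendTP_consTP, ← castTP_applyAt, ih,
        add_right_comm p 1 i, applyAt_consTP]
    exact LinearMap.congr_fun this x

lemma appendTP_applyAt_left (p q i : ℕ) (hi : i + 1 < p) (x : TP K V p) (y : TP K V q) :
    appendTP p q y (applyAt K V σ p i x) = applyAt K V σ (p + q) i (appendTP p q y x) := by
  induction p generalizing i with
  | zero => omega
  | succ p ih =>
    suffices h : appendTP (p + 1) q y ∘ₗ applyAt K V σ (p + 1) i =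
        applyAt K V σ (p + 1 + q) i ∘ₗ appendTP (p + 1) q y from LinearMap.congr_fun h x
    match p, i with
    | 0, _ => omega
    | p + 1, 0 =>
      refine TP_add_two_ext fun t x => ?_
      rw [LinearMap.comp_apply, LinearMap.comp_apply, applyAt_zero_consTwoTP, appendTP_consTwoTP,
        appendTP_consTwoTP, ← castTP_applyAt, applyAt_zero_consTwoTP]
    | p + 1, i + 1 =>
      refine TP_succ_ext fun v x => ?_
      rw [LinearMap.comp_apply, LinearMap.comp_apply, applyAt_consTP, appendTP_consTP,
        appendTP_consTP, ← castTP_applyAt, applyAt_consTP, ih _ (by omega)]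

lemma appendTP_castTP_right {m n : ℕ} (h : m = n) (q : ℕ) (x : TP K V m) (y : TP K V q) :
    appendTP n q y (castTP K V h x) =
      castTP K V (congrArg (· + q) h) (appendTP m q y x) := by
  subst h; rfl

lemma appendTP_appendTP (p q r : ℕ) (x : TP K V p) (y : TP K V q) (z : TP K V r) :
    appendTP (p + q) r z (appendTP p q y x) =
      castTP K V (add_assoc p q r).symm (appendTP p (q + r) (appendTP q r z y) x) := by
  induction p with
  | zero =>
    rw [appendTP_zero, appendTP_zero, appendTP_castTP_right, castTP_castTP, map_smul]
  | succ p ih =>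
    suffices h : appendTP (p + 1 + q) r z ∘ₗ appendTP (p + 1) q y =
        castTP K V (add_assoc (p + 1) q r).symm ∘ₗ appendTP (p + 1) (q + r) (appendTP q r z y)
      from LinearMap.congr_fun h x
    refine TP_succ_ext fun v x => ?_
    rw [LinearMap.comp_apply, LinearMap.comp_apply, appendTP_consTP, appendTP_consTP,
      appendTP_castTP_right, appendTP_consTP, ih, castTP_castTP, castTP_castTP,
      ← castTP_consTP (by omega), castTP_castTP]

lemma applyAt_mul_of_far (n i j : ℕ) (h : i + 2 ≤ j) :
    (applyAt K V σ n i * applyAt K V σ n j : Module.End K (TP K V n)) =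
      applyAt K V σ n j * applyAt K V σ n i := by
  induction n generalizing i j with
  | zero => rfl
  | succ n ih =>
    match n, i, j with
    | 0, _, _ => rfl
    | n + 1, 0, j + 2 =>
      refine TP_add_two_ext fun t x => ?_
      rw [Module.End.mul_apply, Module.End.mul_apply, applyAt_consTwoTP, applyAt_zero_consTwoTP,
        applyAt_zero_consTwoTP, applyAt_consTwoTP]
    | n + 1, i + 1, j + 1 =>
      refine TP_succ_ext fun v x => ?_
      have := LinearMap.congr_fun (ih i j (by omega)) x
      rw [Module.End.mul_apply, Module.End.mul_apply] at this ⊢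
      rw [applyAt_consTP, applyAt_consTP, applyAt_consTP, applyAt_consTP, this]

lemma applyAt_braid
    (hbraid : applyAt K V σ 3 0 ∘ₗ applyAt K V σ 3 1 ∘ₗ applyAt K V σ 3 0 =
      applyAt K V σ 3 1 ∘ₗ applyAt K V σ 3 0 ∘ₗ applyAt K V σ 3 1) (n i : ℕ) (h : i + 2 < n) :
    (applyAt K V σ n i * applyAt K V σ n (i + 1) * applyAt K V σ n i : Module.End K (TP K V n)) =
      applyAt K V σ n (i + 1) * applyAt K V σ n i * applyAt K V σ n (i + 1) := by
  induction n generalizing i with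
  | zero => omega
  | succ n ih =>
    cases i with
    | succ i =>
      refine TP_succ_ext fun v x => ?_
      have := LinearMap.congr_fun (ih i (by omega)) x
      simp only [Module.End.mul_apply] at this ⊢
      simp only [applyAt_consTP, this]
    | zero =>
      obtain ⟨m, rfl⟩ : ∃ m, n = m + 2 := ⟨n - 2, by omega⟩
      refine TP_succ_ext fun u x => ?_
      suffices H : (applyAt K V σ (m + 3) 0 * applyAt K V σ (m + 3) 1 *
          applyAt K V σ (m + 3) 0 : Module.End K (TP K V (m + 3))) ∘ₗ consTP (m + 2) u =
          (applyAt K V σ (m + 3) 1 * applyAt K V σ (m + 3) 0 *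
          applyAt K V σ (m + 3) 1 : Module.End K (TP K V (m + 3))) ∘ₗ consTP (m + 2) u from
        LinearMap.congr_fun H x
      refine TP_add_two_ext fun t x => ?_
      have e : ∀ t : V ⊗[K] V, consTP (m + 2) u (consTwoTP m x t) = castTP K V (add_comm 3 m)
          (appendTP 3 m x (consTP 2 u (consTwoTP 0 oneTP t))) := by
        intro t
        have e2 : appendTP 2 m x (consTwoTP 0 oneTP t) =
            castTP K V (add_comm m 2) (consTwoTP m x t) := by
          refine (appendTP_consTwoTP 0 m t oneTP x).trans ?_
          rw [appendTP_zero, scalarTP_oneTP, one_smul]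
          have : ∀ l (hl : m = l) (h : l + 2 = 2 + m),
              castTP K V h (consTwoTP l (castTP K V hl x) t) =
                castTP K V (add_comm m 2) (consTwoTP m x t) := by
            rintro _ rfl h; rfl
          exact this _ _ _
        rw [appendTP_consTP, e2, castTP_castTP, castTP_consTP, castTP_castTP, castTP_self]
      have key := LinearMap.congr_fun hbraid (consTP 2 u (consTwoTP 0 oneTP t))
      simp only [LinearMap.comp_apply] at key
      simp only [LinearMap.comp_apply, Module.End.mul_apply]
      rw [e]
      have a0 : ∀ z, applyAt K V σ (m + 3) 0 (castTP K V (add_comm 3 m) (appendTP 3 m x z)) =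
          castTP K V (add_comm 3 m) (appendTP 3 m x (applyAt K V σ 3 0 z)) := fun z => by
        rw [appendTP_applyAt_left _ _ _ (by omega), castTP_applyAt]
      have a1 : ∀ z, applyAt K V σ (m + 3) 1 (castTP K V (add_comm 3 m) (appendTP 3 m x z)) =
          castTP K V (add_comm 3 m) (appendTP 3 m x (applyAt K V σ 3 1 z)) := fun z => by
        rw [appendTP_applyAt_left _ _ _ (by omega), castTP_applyAt]
      rw [a0, a1, a0, a1, a0, a1, key]

end TensorPowers

section Permutations

variable {n : ℕ}

lemma simpleT_apply (i : Fin (n - 1)) (a : Fin n) :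
    (simpleT n i a : ℕ) = if (a : ℕ) = i then (i : ℕ) + 1 else if (a : ℕ) = i + 1 then i else a := by
  simp only [simpleT, Equiv.swap_apply_def, Fin.ext_iff]
  split_ifs <;> rfl

lemma simpleT_mul_self (i : Fin (n - 1)) : simpleT n i * simpleT n i = 1 :=
  Equiv.swap_mul_self _ _

lemma simpleT_mul_comm (i j : Fin (n - 1)) (h : (i : ℕ) + 2 ≤ j) :
    simpleT n i * simpleT n j = simpleT n j * simpleT n i := by
  ext a
  simp only [Equiv.Perm.mul_apply, simpleT_apply]
  grind

lemma simpleT_braid (i j : Fin (n - 1)) (h : (j : ℕ) = i + 1) :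
    simpleT n i * simpleT n j * simpleT n i = simpleT n j * simpleT n i * simpleT n j := by
  ext a
  simp only [Equiv.Perm.mul_apply, simpleT_apply]
  grind

/-- The lower position exchanged by the simple transposition `simpleT n i`. -/
def lowPos (i : Fin (n - 1)) : Fin n := ⟨i, by omega⟩

/-- The upper position exchanged by the simple transposition `simpleT n i`. -/
def highPos (i : Fin (n - 1)) : Fin n := ⟨i + 1, by omega⟩

@[simp] lemma val_lowPos (i : Fin (n - 1)) : (lowPos i : ℕ) = i := rfl

@[simp] lemma val_highPos (i : Fin (n - 1)) : (highPos i : ℕ) = i + 1 := rfl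

lemma simpleT_lowPos (i : Fin (n - 1)) : simpleT n i (lowPos i) = highPos i :=
  Equiv.swap_apply_left _ _

lemma simpleT_highPos (i : Fin (n - 1)) : simpleT n i (highPos i) = lowPos i :=
  Equiv.swap_apply_right _ _

/-- The inversions of a permutation. -/
def inversions (w : Equiv.Perm (Fin n)) : Finset (Fin n × Fin n) :=
  {x | x.1 < x.2 ∧ w x.2 < w x.1}

lemma mem_inversions {w : Equiv.Perm (Fin n)} {x : Fin n × Fin n} :
    x ∈ inversions w ↔ x.1 < x.2 ∧ w x.2 < w x.1 := by
  simp [inversions]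

lemma card_inversions_mul_simpleT {w : Equiv.Perm (Fin n)} {i : Fin (n - 1)}
    (h : w (lowPos i) < w (highPos i)) :
    (inversions (w * simpleT n i)).card = (inversions w).card + 1 := by
  let e : Fin n × Fin n ↪ Fin n × Fin n :=
    ((simpleT n i).prodCongr (simpleT n i)).toEmbedding
  have hs : ∀ a, simpleT n i (simpleT n i a) = a := fun a => by
    rw [← Equiv.Perm.mul_apply, simpleT_mul_self, Equiv.Perm.one_apply]
  have hnot : (lowPos i, highPos i) ∉ (inversions w).map e := by
    simp only [Finset.mem_map, mem_inversions, not_exists, not_and]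
    rintro ⟨a, b⟩ ⟨hab, -⟩ heq
    simp only [e, Equiv.coe_toEmbedding, Equiv.prodCongr_apply, Prod.map_apply, Prod.mk.injEq] at heq
    have ha : a = highPos i := by rw [← hs a, heq.1, simpleT_lowPos]
    have hb : b = lowPos i := by rw [← hs b, heq.2, simpleT_highPos]
    simp only [ha, hb, Fin.lt_def, val_highPos, val_lowPos] at hab
    omega
  rw [← Finset.card_map e (s := inversions w), ← Finset.card_cons hnot]
  congr 1
  ext ⟨a, b⟩
  simp only [Finset.mem_cons, Finset.mem_map, mem_inversions, Equiv.Perm.mul_apply, Prod.mk.injEq]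
  constructor
  · rintro ⟨hab, hw⟩
    by_cases hi : a = lowPos i ∧ b = highPos i
    · exact Or.inl hi
    · refine Or.inr ⟨(simpleT n i a, simpleT n i b), ⟨?_, hw⟩, by simp [e, hs]⟩
      simp only [Fin.ext_iff, val_lowPos, val_highPos] at hi
      simp only [Fin.lt_def, simpleT_apply] at hab ⊢
      grind
  · rintro (⟨rfl, rfl⟩ | ⟨⟨c, d⟩, ⟨hcd, hw⟩, he⟩)
    · refine ⟨by simp [Fin.lt_def], ?_⟩
      rwa [simpleT_lowPos, simpleT_highPos]
    · simp only [e, Equiv.coe_toEmbedding, Equiv.prodCongr_apply, Prod.map_apply,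
        Prod.mk.injEq] at he
      obtain ⟨rfl, rfl⟩ := he
      rw [hs, hs]
      refine ⟨?_, hw⟩
      have hi : ¬ (c = lowPos i ∧ d = highPos i) := by
        rintro ⟨rfl, rfl⟩
        exact absurd h (not_lt.2 hw.le)
      simp only [Fin.ext_iff, val_lowPos, val_highPos] at hi
      simp only [Fin.lt_def, simpleT_apply] at hcd ⊢
      grind

lemma mul_simpleT_mul_simpleT (w : Equiv.Perm (Fin n)) (i : Fin (n - 1)) :
    w * simpleT n i * simpleT n i = w := by
  rw [mul_assoc, simpleT_mul_self, mul_one]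

lemma lowPos_ne_highPos (i : Fin (n - 1)) : lowPos i ≠ highPos i := by
  simp [Fin.ext_iff]

lemma card_inversions_of_descent {w : Equiv.Perm (Fin n)} {i : Fin (n - 1)}
    (h : w (highPos i) < w (lowPos i)) :
    (inversions w).card = (inversions (w * simpleT n i)).card + 1 := by
  rw [← card_inversions_mul_simpleT (w := w * simpleT n i) (i := i), mul_simpleT_mul_simpleT]
  rwa [Equiv.Perm.mul_apply, Equiv.Perm.mul_apply, simpleT_lowPos, simpleT_highPos]

lemma card_inversions_mul_simpleT_le (w : Equiv.Perm (Fin n)) (i : Fin (n - 1)) :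
    (inversions (w * simpleT n i)).card ≤ (inversions w).card + 1 := by
  rcases lt_or_gt_of_ne (w.injective.ne (lowPos_ne_highPos i)) with h | h
  · exact (card_inversions_mul_simpleT h).le
  · have := card_inversions_of_descent h
    omega

lemma inversions_one : inversions (1 : Equiv.Perm (Fin n)) = ∅ := by
  ext x
  simpa [mem_inversions] using fun h : x.1 < x.2 => h.le

lemma perm_eq_one_of_strictMono {w : Equiv.Perm (Fin n)} (h : StrictMono w) : w = 1 := by
  have : h.orderIsoOfSurjective w w.surjective = OrderIso.refl _ := Subsingleton.elim _ _
  ext a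
  exact congrArg Fin.val (DFunLike.congr_fun this a)

lemma exists_descent {w : Equiv.Perm (Fin n)} (h : w ≠ 1) :
    ∃ i : Fin (n - 1), w (highPos i) < w (lowPos i) := by
  by_contra! hw
  refine h (perm_eq_one_of_strictMono ?_)
  cases n with
  | zero => exact fun a => a.elim0
  | succ n =>
    refine Fin.strictMono_iff_lt_succ.2 fun i => ?_
    exact (hw i).lt_of_ne (w.injective.ne (lowPos_ne_highPos (n := n + 1) i))

/-- The permutation obtained from a word by letting the first letter act first. -/
def revWordPerm (n : ℕ) : List (Fin (n - 1)) → Equiv.Perm (Fin n)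
  | [] => 1
  | i :: u => revWordPerm n u * simpleT n i

lemma revWordPerm_eq (u : List (Fin (n - 1))) :
    revWordPerm n u = (wordPerm n (FreeMonoid.ofList u))⁻¹ := by
  induction u with
  | nil => simp [revWordPerm]
  | cons i u ih =>
    rw [revWordPerm, ih, FreeMonoid.ofList_cons, map_mul, mul_inv_rev]
    rw [wordPerm, FreeMonoid.lift_eval_of, inv_eq_of_mul_eq_one_left (simpleT_mul_self i)]

lemma card_inversions_revWordPerm_le (u : List (Fin (n - 1))) :
    (inversions (revWordPerm n u)).card ≤ u.length := by
  induction u with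
  | nil => simp [revWordPerm, inversions_one]
  | cons i u ih =>
    exact (card_inversions_mul_simpleT_le _ i).trans (Nat.succ_le_succ ih)

lemma exists_reduced_word (w : Equiv.Perm (Fin n)) :
    ∃ u, revWordPerm n u = w ∧ u.length = (inversions w).card := by
  induction hk : (inversions w).card generalizing w with
  | zero =>
    refine ⟨[], ?_, rfl⟩
    by_contra h
    obtain ⟨i, hi⟩ := exists_descent (w := w) (fun h' => h h'.symm)
    have := card_inversions_of_descent hi
    omega
  | succ k ih =>
    have hw : w ≠ 1 := by
      rintro rfl
      simp [inversions_one] at hk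
    obtain ⟨i, hi⟩ := exists_descent hw
    have := card_inversions_of_descent hi
    obtain ⟨u, hu, hl⟩ := ih (w * simpleT n i) (by omega)
    exact ⟨i :: u, by rw [revWordPerm, hu, mul_simpleT_mul_simpleT], by simp [hl]⟩

lemma permLength_le_card_inversions (s : Equiv.Perm (Fin n)) :
    permLength s ≤ (inversions s⁻¹).card := by
  obtain ⟨u, hu, hl⟩ := exists_reduced_word s⁻¹
  refine Nat.sInf_le ⟨u.map (simpleT n), ?_, ?_, by simpa using hl⟩
  · intro x hx
    obtain ⟨i, -, rfl⟩ := List.mem_map.1 hx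
    exact ⟨i, by omega, rfl⟩
  · rw [revWordPerm_eq, inv_inj] at hu
    rw [← hu, wordPerm, FreeMonoid.lift_apply]
    rfl

variable {M : Type*} [Monoid M] (f : ℕ → M)

/-- The value of a word in a monoid, with the first letter as the rightmost factor. -/
def revWordProd (f : ℕ → M) : List (Fin (n - 1)) → M
  | [] => 1
  | i :: u => revWordProd f u * f i

lemma revWordProd_eq (u : List (Fin (n - 1))) :
    revWordProd f u = ((u.map fun i => f i).reverse).prod := by
  induction u with
  | nil => rfl
  | cons i u ih => simp [revWordProd, ih]

/-- Matsumoto's theorem for the symmetric group. -/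
theorem revWordProd_eq_of_reduced {f : ℕ → M}
    (hfar : ∀ i j, i + 2 ≤ j → f i * f j = f j * f i)
    (hbraid : ∀ i, i + 2 < n → f i * f (i + 1) * f i = f (i + 1) * f i * f (i + 1))
    {u v : List (Fin (n - 1))} (huv : revWordPerm n u = revWordPerm n v)
    (hu : u.length = (inversions (revWordPerm n u)).card) (hl : v.length = u.length) :
    revWordProd f u = revWordProd f v := by
  induction hk : u.length generalizing u v with
  | zero =>
    rw [List.length_eq_zero_iff.1 hk, List.length_eq_zero_iff.1 (hl.trans hk)]
  | succ k ih =>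
    obtain ⟨i, u, rfl⟩ := List.exists_cons_of_length_eq_add_one hk
    obtain ⟨j, v, rfl⟩ := List.exists_cons_of_length_eq_add_one (hl.trans hk)
    wlog hij : i ≤ j generalizing i j u v
    · exact (this j v (by rw [← huv, hl, hu]) (hl.trans hk) i u huv.symm hl.symm
        (le_of_not_ge hij)).symm
    set w := revWordPerm n (i :: u) with hw
    simp only [List.length_cons, add_left_inj] at hk hl
    have hlen : (inversions w).card = k + 1 := by simpa [hk] using hu.symm
    have hdesc : ∀ (i : Fin (n - 1)) (u : List (Fin (n - 1))), u.length = k →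
        w = revWordPerm n (i :: u) → w (highPos i) < w (lowPos i) ∧
        revWordPerm n u = w * simpleT n i ∧ u.length = (inversions (revWordPerm n u)).card := by
      intro i u hk hw
      have e : revWordPerm n u = w * simpleT n i := by
        rw [hw, revWordPerm, mul_simpleT_mul_simpleT]
      have h1 := card_inversions_revWordPerm_le u
      rcases lt_or_gt_of_ne (w.injective.ne (lowPos_ne_highPos i)) with h | h
      · have := card_inversions_mul_simpleT h
        rw [e] at h1
        omega
      · have := card_inversions_of_descent h
        exact ⟨h, e, by rw [e]; omega⟩
    obtain ⟨di, ei, ri⟩ := hdesc i u hk hw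
    obtain ⟨dj, ej, rj⟩ := hdesc j v (hl.trans hk) huv
    simp only [revWordProd]
    rcases hij.eq_or_lt with rfl | hlt
    · rw [ih (ei.trans ej.symm) ri hl hk]
    rcases Nat.lt_or_ge (i + 1) j with hgap | hadj
    · have d2 : (w * simpleT n i) (highPos j) < (w * simpleT n i) (lowPos j) := by
        have h1 : simpleT n i (highPos j) = highPos j := by
          ext; simp only [simpleT_apply, val_highPos]; grind
        have h2 : simpleT n i (lowPos j) = lowPos j := by
          ext; simp only [simpleT_apply, val_lowPos]; grind
        rwa [Equiv.Perm.mul_apply, Equiv.Perm.mul_apply, h1, h2]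
      obtain ⟨x, hx, hxl⟩ := exists_reduced_word (w * simpleT n i * simpleT n j)
      have c1 := card_inversions_of_descent di
      have c2 := card_inversions_of_descent d2
      have q1 : revWordPerm n u = revWordPerm n (j :: x) := by
        rw [revWordPerm, hx, mul_simpleT_mul_simpleT, ei]
      have q2 : revWordPerm n v = revWordPerm n (i :: x) := by
        rw [revWordPerm, hx, mul_assoc w, simpleT_mul_comm i j hgap, ← mul_assoc,
          mul_simpleT_mul_simpleT, ej]
      rw [ih q1 ri (by simp; omega) hk, ih q2 rj (by simp; omega) (hl.trans hk)]
      simp only [revWordProd, mul_assoc]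
      rw [hfar i j hgap]
    · have hj : (j : ℕ) = i + 1 := by have := Fin.lt_def.1 hlt; omega
      have hh : lowPos j = highPos i := by ext; simp [hj]
      have h1 : simpleT n i (highPos j) = highPos j := by
        ext; simp only [simpleT_apply, val_highPos]; grind
      have h2 : simpleT n j (lowPos i) = lowPos i := by
        ext; simp only [simpleT_apply, val_lowPos]; grind
      have d2 : (w * simpleT n i) (highPos j) < (w * simpleT n i) (lowPos j) := by
        rw [Equiv.Perm.mul_apply, Equiv.Perm.mul_apply, h1, hh, simpleT_highPos]
        rw [← hh] at di
        exact dj.trans di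
      have d3 : (w * simpleT n i * simpleT n j) (highPos i) <
          (w * simpleT n i * simpleT n j) (lowPos i) := by
        simp only [Equiv.Perm.mul_apply]
        rw [h2, ← hh, simpleT_lowPos, h1, simpleT_lowPos, ← hh]
        exact dj
      obtain ⟨x, hx, hxl⟩ := exists_reduced_word (w * simpleT n i * simpleT n j * simpleT n i)
      have c1 := card_inversions_of_descent di
      have c2 := card_inversions_of_descent d2
      have c3 := card_inversions_of_descent d3
      have q1 : revWordPerm n u = revWordPerm n (j :: i :: x) := by
        rw [revWordPerm, revWordPerm, hx, mul_simpleT_mul_simpleT, mul_simpleT_mul_simpleT, ei]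
      have q2 : revWordPerm n v = revWordPerm n (i :: j :: x) := by
        have := simpleT_braid i j hj
        rw [revWordPerm, revWordPerm, hx, mul_assoc w, mul_assoc w, this, ← mul_assoc, ← mul_assoc,
          mul_simpleT_mul_simpleT, mul_simpleT_mul_simpleT, ej]
      rw [ih q1 ri (by simp; omega) hk, ih q2 rj (by simp; omega) (hl.trans hk)]
      simp only [revWordProd, mul_assoc]
      have := hbraid i (by omega)
      rw [hj, ← mul_assoc (f i), this, mul_assoc]

end Permutations

section ShuffleSums

variable {n : ℕ}

open scoped Classical in
/-- The inverses of the `(p, q)`-shuffles of the first `p + q` elements of `Fin n`. -/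
noncomputable def invShuffles (n p q : ℕ) : Finset (Equiv.Perm (Fin n)) :=
  {w | IsShuffleOn 0 p q w⁻¹}

lemma mem_invShuffles {p q : ℕ} {w : Equiv.Perm (Fin n)} :
    w ∈ invShuffles n p q ↔ (∀ a : Fin n, p + q ≤ a → w a = a) ∧
      (∀ a b : Fin n, a < b → (b : ℕ) < p → w a < w b) ∧
      (∀ a b : Fin n, a < b → p ≤ (a : ℕ) → (b : ℕ) < p + q → w a < w b) := by
  simp only [invShuffles, Finset.mem_filter, Finset.mem_univ, true_and, IsShuffleOn, zero_add,
    not_lt_zero, false_or, zero_le, forall_const]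
  refine and_congr (forall₂_congr fun a _ => ?_) Iff.rfl
  rw [Equiv.Perm.inv_eq_iff_eq, eq_comm]

lemma apply_lt_of_fixed {w : Equiv.Perm (Fin n)} {m : ℕ} (h : ∀ a : Fin n, m ≤ a → w a = a)
    {a : Fin n} (ha : (a : ℕ) < m) : (w a : ℕ) < m := by
  by_contra! hm
  have := w.injective (h _ hm)
  rw [this] at hm
  omega

lemma eq_one_of_fixed_of_lt {w : Equiv.Perm (Fin n)} {m : ℕ} (h : ∀ a : Fin n, m ≤ a → w a = a)
    (hlt : ∀ a b : Fin n, a < b → (b : ℕ) < m → w a < w b) : w = 1 := by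
  refine perm_eq_one_of_strictMono fun a b hab => ?_
  rcases Nat.lt_or_ge b m with hb | hb
  · exact hlt a b hab hb
  · rw [h b hb]
    rcases Nat.lt_or_ge a m with ha | ha
    · exact Fin.lt_def.2 ((apply_lt_of_fixed h ha).trans_le hb)
    · rwa [h a ha]

lemma invShuffles_zero_left (q : ℕ) : invShuffles n 0 q = {1} := by
  ext w
  rw [mem_invShuffles, Finset.mem_singleton]
  refine ⟨fun h => eq_one_of_fixed_of_lt h.1 fun a b hab => h.2.2 a b hab (Nat.zero_le _), ?_⟩
  rintro rfl
  exact ⟨fun _ _ => rfl, fun _ _ h _ => h, fun _ _ h _ _ => h⟩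

lemma invShuffles_zero_right (p : ℕ) : invShuffles n p 0 = {1} := by
  ext w
  rw [mem_invShuffles, Finset.mem_singleton]
  refine ⟨fun h => eq_one_of_fixed_of_lt h.1 h.2.1, ?_⟩
  rintro rfl
  exact ⟨fun _ _ => rfl, fun _ _ h _ => h, fun _ _ h _ _ => h⟩

/-- The cycle sending `b` to `b + k` and shifting `b + 1, …, b + k` down by one. -/
def shiftCycle (n : ℕ) : ℕ → ℕ → Equiv.Perm (Fin n)
  | _, 0 => 1
  | b, k + 1 => shiftCycle n (b + 1) k * if h : b < n - 1 then simpleT n ⟨b, h⟩ else 1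

lemma shiftCycle_succ {b k : ℕ} (h : b < n - 1) :
    shiftCycle n b (k + 1) = shiftCycle n (b + 1) k * simpleT n ⟨b, h⟩ := by
  rw [shiftCycle, dif_pos h]

lemma shiftCycle_apply {b k : ℕ} (h : b + k < n) (a : Fin n) :
    (shiftCycle n b k a : ℕ) =
      if (a : ℕ) < b then (a : ℕ) else if (a : ℕ) = b then b + k
        else if (a : ℕ) ≤ b + k then (a : ℕ) - 1 else a := by
  induction k generalizing b a with
  | zero => simp only [shiftCycle, Equiv.Perm.one_apply]; grind
  | succ k ih =>
    rw [shiftCycle_succ (by omega), Equiv.Perm.mul_apply, ih (by omega), simpleT_apply]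
    grind

variable {K M : Type*} [CommSemiring K] [AddCommMonoid M] [Module K M]

lemma map_mul_shiftCycle {A : ℕ → Module.End K M} {T : Equiv.Perm (Fin n) → Module.End K M}
    (hT : ∀ (w : Equiv.Perm (Fin n)) (i : Fin (n - 1)), w (lowPos i) < w (highPos i) →
      T (w * simpleT n i) = T w * A i) {b k : ℕ} (h : b + k < n) {w : Equiv.Perm (Fin n)}
    (hw : ∀ a : Fin n, b + k ≤ a → w a = a) :
    T (w * shiftCycle n b k) = T w * descProd A b k := by
  induction k generalizing b with
  | zero => simp [shiftCycle, descProd]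
  | succ k ih =>
    rw [shiftCycle_succ (by omega), ← mul_assoc, hT, ih (by omega) (by grind), descProd, mul_assoc]
    rw [Equiv.Perm.mul_apply, Equiv.Perm.mul_apply]
    have h1 : shiftCycle n (b + 1) k (lowPos ⟨b, by omega⟩) = ⟨b, by omega⟩ := by
      ext; rw [shiftCycle_apply (by omega)]; simp
    have h2 : shiftCycle n (b + 1) k (highPos ⟨b, by omega⟩) = ⟨b + (k + 1), h⟩ := by
      ext; rw [shiftCycle_apply (by omega)]; simp; omega
    rw [h1, h2, hw ⟨b + (k + 1), h⟩ le_rfl]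
    exact Fin.lt_def.2 (apply_lt_of_fixed hw (by simp))

lemma mul_shiftCycle_mem_invShuffles {p q : ℕ} (h : p + (q + 1) < n) {w : Equiv.Perm (Fin n)} :
    w ∈ invShuffles n p (q + 1) ↔ w * shiftCycle n p (q + 1) ∈ invShuffles n (p + 1) (q + 1) ∧
      ((w * shiftCycle n p (q + 1)) ⟨p, by omega⟩ : ℕ) = p + (q + 1) := by
  have hr := fun a => shiftCycle_apply h a
  have hp : shiftCycle n p (q + 1) ⟨p, by omega⟩ = ⟨p + (q + 1), h⟩ := by
    ext; rw [hr]; simp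
  have hout : ∀ a : Fin n, (a : ℕ) < p ∨ p + (q + 1) < a → shiftCycle n p (q + 1) a = a := by
    intro a ha; ext; rw [hr]; grind
  have hin : ∀ a b : Fin n, p ≤ (b : ℕ) → (b : ℕ) < p + (q + 1) → (a : ℕ) = b + 1 →
      shiftCycle n p (q + 1) a = b := by
    intro a b h1 h2 h3; ext; rw [hr]; grind
  simp only [mem_invShuffles, Equiv.Perm.mul_apply, hp]
  constructor
  · rintro ⟨hf, h1, h2⟩
    have htop := hf ⟨p + (q + 1), h⟩ le_rfl
    refine ⟨⟨fun a ha => ?_, fun a b hab hb => ?_, fun a b hab ha hb => ?_⟩, by rw [htop]⟩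
    · rw [hout a (by omega), hf a (by omega)]
    · rw [hout a (by omega)]
      rcases Nat.lt_succ_iff_lt_or_eq.1 hb with hb | hb
      · rw [hout b (by omega)]
        exact h1 a b hab hb
      · have hbp : b = ⟨p, by omega⟩ := Fin.ext hb
        rw [hbp, hp, htop]
        exact Fin.lt_def.2 (apply_lt_of_fixed hf (by simp only [Fin.lt_def] at hab; omega))
    · rw [Fin.lt_def] at hab
      rw [hin a ⟨a - 1, by omega⟩ (by simp; omega) (by simp; omega) (by simp; omega),
        hin b ⟨b - 1, by omega⟩ (by simp; omega) (by simp; omega) (by simp; omega)]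
      exact h2 _ _ (by simp only [Fin.lt_def]; omega) (by simp; omega) (by simp; omega)
  · rintro ⟨⟨hf, h1, h2⟩, htop⟩
    refine ⟨fun a ha => ?_, fun a b hab hb => ?_, fun a b hab ha hb => ?_⟩
    · rcases ha.eq_or_lt with ha | ha
      · obtain rfl : a = ⟨p + (q + 1), h⟩ := Fin.ext ha.symm
        exact Fin.ext htop
      · have := hf a (by omega)
        rwa [hout a (by omega)] at this
    · have := h1 a b hab (by omega)
      rw [Fin.lt_def] at hab
      rwa [hout a (by omega), hout b (by omega)] at this
    · rw [Fin.lt_def] at hab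
      have := h2 ⟨a + 1, by omega⟩ ⟨b + 1, by omega⟩ (Fin.lt_def.2 (Nat.succ_lt_succ hab))
        (by simp; omega) (by simp; omega)
      rwa [hin ⟨a + 1, by omega⟩ a (by omega) (by omega) rfl,
        hin ⟨b + 1, by omega⟩ b (by omega) (by omega) rfl] at this

lemma mem_invShuffles_of_apply_eq {p q : ℕ} (h : p + (q + 1) < n) {w : Equiv.Perm (Fin n)} :
    w ∈ invShuffles n (p + 1) q ↔ w ∈ invShuffles n (p + 1) (q + 1) ∧
      (w ⟨p + (q + 1), h⟩ : ℕ) = p + (q + 1) := by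
  simp only [mem_invShuffles]
  constructor
  · rintro ⟨hf, h1, h2⟩
    have htop := hf ⟨p + (q + 1), h⟩ (by simp; omega)
    refine ⟨⟨fun a ha => hf a (by omega), h1, fun a b hab ha hb => ?_⟩, by rw [htop]⟩
    rcases Nat.lt_or_ge b (p + 1 + q) with hb' | hb'
    · exact h2 a b hab ha hb'
    · rw [hf b hb']
      rw [Fin.lt_def] at hab ⊢
      have := apply_lt_of_fixed hf (a := a) (by omega)
      omega
  · rintro ⟨⟨hf, h1, h2⟩, htop⟩
    refine ⟨fun a ha => ?_, h1, fun a b hab ha hb => h2 a b hab ha (by omega)⟩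
    rcases Nat.lt_or_ge a (p + 1 + (q + 1)) with ha' | ha'
    · obtain rfl : a = ⟨p + (q + 1), h⟩ := Fin.ext (by simp; omega)
      exact Fin.ext htop
    · exact hf a ha'

lemma apply_eq_or_apply_eq_of_mem_invShuffles {p q : ℕ} (h : p + (q + 1) < n)
    {w : Equiv.Perm (Fin n)} (hw : w ∈ invShuffles n (p + 1) (q + 1)) :
    (w ⟨p + (q + 1), h⟩ : ℕ) = p + (q + 1) ∨ (w ⟨p, by omega⟩ : ℕ) = p + (q + 1) := by
  obtain ⟨hf, h1, h2⟩ := mem_invShuffles.1 hw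
  obtain ⟨t, ht⟩ := w.surjective ⟨p + (q + 1), h⟩
  have htv : (w t : ℕ) = p + (q + 1) := by rw [ht]
  have hlt : (t : ℕ) < p + 1 + (q + 1) := by
    by_contra! hge
    rw [hf t hge] at htv
    omega
  rcases lt_trichotomy (t : ℕ) p with hp | hp | hp
  · have := Fin.lt_def.1 (h1 t ⟨p, by omega⟩ (by simpa [Fin.lt_def] using hp) (by simp))
    have := apply_lt_of_fixed hf (a := ⟨p, by omega⟩) (by simp; omega)
    omega
  · right
    rwa [show t = ⟨p, by omega⟩ from Fin.ext hp] at htv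
  · left
    rcases Nat.lt_or_ge t (p + (q + 1)) with hq | hq
    · have := Fin.lt_def.1 (h2 t ⟨p + (q + 1), h⟩ (by simpa [Fin.lt_def] using hq) hp
        (by simp only; omega))
      have := apply_lt_of_fixed hf (a := ⟨p + (q + 1), h⟩) (by simp only; omega)
      omega
    · rwa [show t = ⟨p + (q + 1), h⟩ from Fin.ext (by simp; omega)] at htv

/-- A function on permutations which is multiplicative along reduced words sums over the inverse
shuffles to `shuffleSum`. -/
lemma sum_invShuffles {A : ℕ → Module.End K M} {T : Equiv.Perm (Fin n) → Module.End K M}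
    (hone : T 1 = 1)
    (hT : ∀ (w : Equiv.Perm (Fin n)) (i : Fin (n - 1)), w (lowPos i) < w (highPos i) →
      T (w * simpleT n i) = T w * A i) (p q : ℕ) (h : p + q ≤ n) :
    ∑ w ∈ invShuffles n p q, T w = shuffleSum A 0 p q := by
  classical
  match p, q with
  | 0, q => simp [invShuffles_zero_left, hone]
  | p, 0 => simp [invShuffles_zero_right, hone]
  | p + 1, q + 1 =>
    have hn : p + (q + 1) < n := by omega
    let e := (Equiv.mulRight (shiftCycle n p (q + 1))).toEmbedding
    have hmem : ∀ w, w ∈ (invShuffles n p (q + 1)).map e ↔ w ∈ invShuffles n (p + 1) (q + 1) ∧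
        (w ⟨p, by omega⟩ : ℕ) = p + (q + 1) := by
      intro w
      simp only [Finset.mem_map, e, Equiv.coe_toEmbedding, Equiv.coe_mulRight]
      constructor
      · rintro ⟨v, hv, rfl⟩
        exact (mul_shiftCycle_mem_invShuffles hn).1 hv
      · intro hw
        refine ⟨w * (shiftCycle n p (q + 1))⁻¹, (mul_shiftCycle_mem_invShuffles hn).2 ?_, by simp⟩
        simpa using hw
    have hdisj : Disjoint (invShuffles n (p + 1) q) ((invShuffles n p (q + 1)).map e) := by
      rw [Finset.disjoint_left]
      intro w h1 h2
      have h3 := ((mem_invShuffles_of_apply_eq hn).1 h1).2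
      have h4 := ((hmem w).1 h2).2
      have := congrArg Fin.val (w.injective (Fin.ext (h3.trans h4.symm)))
      simp at this
    have hunion : invShuffles n (p + 1) (q + 1) =
        (invShuffles n (p + 1) q).disjUnion ((invShuffles n p (q + 1)).map e) hdisj := by
      ext w
      rw [Finset.mem_disjUnion, hmem, mem_invShuffles_of_apply_eq hn, ← and_or_left, iff_self_and]
      exact apply_eq_or_apply_eq_of_mem_invShuffles hn
    rw [hunion, Finset.sum_disjUnion, Finset.sum_map, shuffleSum_succ_succ,
      sum_invShuffles hone hT (p + 1) q (by omega), ← sum_invShuffles hone hT p (q + 1) (by omega),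
      Finset.sum_mul, zero_add]
    congr 1
    refine Finset.sum_congr rfl fun w hw => ?_
    exact map_mul_shiftCycle hT hn (mem_invShuffles.1 hw).1
termination_by p + q

end ShuffleSums

section Products

variable {K : Type u} [Field K] {V : Type u} [AddCommGroup V] [Module K V]
  {σ : V ⊗[K] V →ₗ[K] V ⊗[K] V}

lemma qShuffleProd_eq_shuffleSum
    (hbraid : applyAt K V σ 3 0 ∘ₗ applyAt K V σ 3 1 ∘ₗ applyAt K V σ 3 0 =
      applyAt K V σ 3 1 ∘ₗ applyAt K V σ 3 0 ∘ₗ applyAt K V σ 3 1)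
    {R : ∀ n, Equiv.Perm (Fin n) → List (Fin (n - 1))}
    (hR : ∀ n (s : Equiv.Perm (Fin n)),
      wordPerm n (FreeMonoid.ofList (R n s)) = s ∧ (R n s).length = permLength s)
    (p q : ℕ) (x : TP K V p) (y : TP K V q) :
    qShuffleProd K V σ R p q x y =
      shuffleSum (K := K) (applyAt K V σ (p + q)) 0 p q (appendTP p q y x) := by
  classical
  let T : Equiv.Perm (Fin (p + q)) → Module.End K (TP K V (p + q)) :=
    fun w => revWordProd (applyAt K V σ (p + q) : ℕ → Module.End K (TP K V (p + q))) (R (p + q) w⁻¹)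
  have hw : ∀ w, revWordPerm (p + q) (R (p + q) w⁻¹) = w := fun w => by
    rw [revWordPerm_eq, (hR _ _).1, inv_inv]
  have hl : ∀ w, (R (p + q) w⁻¹).length = (inversions w).card := fun w => by
    refine le_antisymm ?_ ?_
    · rw [(hR _ _).2]
      simpa using permLength_le_card_inversions w⁻¹
    · conv_lhs => rw [← hw w]
      exact card_inversions_revWordPerm_le _
  have hone : T 1 = 1 := by
    have : R (p + q) 1⁻¹ = [] := List.length_eq_zero_iff.1 (by rw [hl, inversions_one]; rfl)
    simp only [T, this, revWordProd]
  have hT : ∀ (w : Equiv.Perm (Fin (p + q))) (i : Fin (p + q - 1)),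
      w (lowPos i) < w (highPos i) → T (w * simpleT (p + q) i) = T w * applyAt K V σ (p + q) i := by
    intro w i hi
    have h1 := card_inversions_mul_simpleT hi
    refine revWordProd_eq_of_reduced (u := R (p + q) (w * simpleT (p + q) i)⁻¹)
      (v := i :: R (p + q) w⁻¹) (applyAt_mul_of_far _) (applyAt_braid hbraid _) ?_ ?_ ?_
    · rw [revWordPerm, hw, hw]
    · rw [hw, hl]
    · rw [List.length_cons, hl, hl, h1]
  rw [← sum_invShuffles hone hT p q le_rfl, LinearMap.sum_apply, qShuffleProd, ← Finset.sum_filter]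
  refine Finset.sum_bij' (fun s _ => s⁻¹) (fun s _ => s⁻¹) ?_ ?_ ?_ ?_ ?_
  · intro s hs
    simpa [invShuffles] using hs
  · intro s hs
    simpa [invShuffles] using hs
  · simp
  · simp
  · intro s _
    simp only [T, inv_inv, revWordProd_eq]
    rfl

end Products

/-- for a braided vector space `(V,σ)` (σ satisfying the braid equation,
expressed here on `V^{⊗3}`), the quantum shuffle product is associative, where `T_s` is
built from any choice `R` of reduced words (by Matsumoto's theorem it does not depend
on this choice).  The two sides are compared via the canonical identification
`V^{⊗(p+q)+r} ≅ V^{⊗p+(q+r)}`. -/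
theorem qShuffleProd_assoc (K : Type u) [Field K] (V : Type u) [AddCommGroup V]
    [Module K V] (σ : V ⊗[K] V →ₗ[K] V ⊗[K] V)
    (hbraid : applyAt K V σ 3 0 ∘ₗ applyAt K V σ 3 1 ∘ₗ applyAt K V σ 3 0 =
      applyAt K V σ 3 1 ∘ₗ applyAt K V σ 3 0 ∘ₗ applyAt K V σ 3 1)
    (R : ∀ n, Equiv.Perm (Fin n) → List (Fin (n - 1)))
    (hR : ∀ n (s : Equiv.Perm (Fin n)),
      wordPerm n (FreeMonoid.ofList (R n s)) = s ∧ (R n s).length = permLength s)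
    (p q r : ℕ) (x : TP K V p) (y : TP K V q) (z : TP K V r) :
    qShuffleProd K V σ R (p + q) r (qShuffleProd K V σ R p q x y) z =
      castTP K V (add_assoc p q r).symm
        (qShuffleProd K V σ R p (q + r) x (qShuffleProd K V σ R q r y z)) := by
  rw [qShuffleProd_eq_shuffleSum hbraid hR, qShuffleProd_eq_shuffleSum hbraid hR,
    qShuffleProd_eq_shuffleSum hbraid hR, qShuffleProd_eq_shuffleSum hbraid hR]
  rw [shuffleSum_intertwine (applyAt K V σ (p + q)) (applyAt K V σ (p + q + r))
    (appendTP (p + q) r z) 0 0 p q (fun i hi x => ?_), appendTP_appendTP]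
  · have hright := shuffleSum_intertwine (applyAt K V σ (q + r)) (applyAt K V σ (p + (q + r)))
      ((combineTP K V p (q + r)) ∘ₗ TensorProduct.mk K _ _ x) 0 p q r
      (fun i _ y => by
        rw [zero_add]
        exact appendTP_applyAt_right p (q + r) i x y) (appendTP q r z y)
    simp only [LinearMap.comp_apply, TensorProduct.mk_apply, combineTP_tmul] at hright
    rw [hright]
    have key := LinearMap.congr_fun (shuffleSum_assoc (K := K) (m := p + q + r)
      (applyAt_mul_of_far (p + q + r)) (applyAt_braid hbraid (p + q + r)) 0 p q r (by omega))
    simp only [Module.End.mul_apply, zero_add] at key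
    rw [key, shuffleSum_intertwine (applyAt K V σ (p + (q + r))) (applyAt K V σ (p + q + r))
      (castTP K V (add_assoc p q r).symm) 0 0 p (q + r) (fun i _ x => ?_),
      shuffleSum_intertwine (applyAt K V σ (p + (q + r))) (applyAt K V σ (p + q + r))
      (castTP K V (add_assoc p q r).symm) p p q r (fun i _ x => ?_)]
    · exact castTP_applyAt _ _ _
    · exact castTP_applyAt _ _ _
  · rw [zero_add]
    exact appendTP_applyAt_left _ _ _ hi _ _
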